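/- Let S be an inverse subsemigroup of FI₁ containing at least one non-idempotent element, and let S̄ be the inverse subsemigroup of S generated by all non-idempotent elements of S. Then the semilattice of idempotents of S̄ has no minimal element: for every idempotent f ∈ S̄ there exists an idempotent g ∈ S̄ with g strictly below f in the natural partial order, i.e. g·f = g and g ≠ f. -/

import Mathlib

/-- Multiplication on triples modeling the monogenic free inverse semigroup:
the triple `(a, p, b)` encodes the element written `(-a, p, b)` in the paper. -/
def FI1mul (u v : ℤ × ℤ × ℤ) : ℤ × ℤ × ℤ :=
  (max u.1 (v.1 - u.2.1), u.2.1 + v.2.1, max u.2.2 (v.2.2 + u.2.1))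

/-- Inversion on triples: `(a, p, b)⁻¹ = (a + p, -p, b - p)`. -/
def FI1inv (u : ℤ × ℤ × ℤ) : ℤ × ℤ × ℤ :=
  (u.1 + u.2.1, -u.2.1, u.2.2 - u.2.1)

/-- The monogenic free inverse semigroup in its concrete triple model:
triples `(a, p, b)` with `a, b ∈ ℕ`, `a + b > 0` and `-a ≤ p ≤ b`. -/
def FI1 : Set (ℤ × ℤ × ℤ) :=
  {u | 0 ≤ u.1 ∧ 0 ≤ u.2.2 ∧ 0 < u.1 + u.2.2 ∧ -u.1 ≤ u.2.1 ∧ u.2.1 ≤ u.2.2}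

/-- Membership in the smallest subset containing `X` that is closed under
multiplication and inversion. -/
inductive FI1genMem (X : Set (ℤ × ℤ × ℤ)) : ℤ × ℤ × ℤ → Prop
  | base {u : ℤ × ℤ × ℤ} : u ∈ X → FI1genMem X u
  | mul {u v : ℤ × ℤ × ℤ} : FI1genMem X u → FI1genMem X v → FI1genMem X (FI1mul u v)
  | inv {u : ℤ × ℤ × ℤ} : FI1genMem X u → FI1genMem X (FI1inv u)

/-- `⟨X⟩`: the smallest subset containing `X` closed under multiplication and inversion. -/
def FI1gen (X : Set (ℤ × ℤ × ℤ)) : Set (ℤ × ℤ × ℤ) := {u | FI1genMem X u}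

/-- A (nonempty) inverse subsemigroup of `FI₁`. -/
def IsInvSub (S : Set (ℤ × ℤ × ℤ)) : Prop :=
  S.Nonempty ∧ S ⊆ FI1 ∧ (∀ u ∈ S, ∀ v ∈ S, FI1mul u v ∈ S) ∧ ∀ u ∈ S, FI1inv u ∈ S

theorem FI1mul_self_iff (u : ℤ × ℤ × ℤ) : FI1mul u u = u ↔ u.2.1 = 0 := by
  obtain ⟨a, p, b⟩ := u
  simp only [FI1mul, Prod.mk.injEq]
  omega

/-- Powers of an element with positive shift have arbitrarily large shift. -/
theorem FI1genMem.exists_lt_shift {X : Set (ℤ × ℤ × ℤ)} {u : ℤ × ℤ × ℤ}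
    (hu : FI1genMem X u) (hpos : 0 < u.2.1) (hle : u.2.1 ≤ u.2.2) (n : ℕ) :
    ∃ v, FI1genMem X v ∧ (n : ℤ) < v.2.1 ∧ v.2.1 ≤ v.2.2 := by
  induction n with
  | zero => exact ⟨u, hu, by simpa using hpos, hle⟩
  | succ n ih =>
    obtain ⟨v, hv, hn, hvle⟩ := ih
    refine ⟨FI1mul v u, hv.mul hu, ?_, ?_⟩ <;> simp only [FI1mul] <;> omega

/-- A set of elements of `FI₁` containing a non-idempotent generates an element of
positive shift. -/
theorem exists_FI1genMem_pos_shift {X : Set (ℤ × ℤ × ℤ)} {u : ℤ × ℤ × ℤ}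
    (hX : u ∈ X) (hu : u ∈ FI1) (hne : u.2.1 ≠ 0) :
    ∃ v, FI1genMem X v ∧ 0 < v.2.1 ∧ v.2.1 ≤ v.2.2 := by
  obtain ⟨-, hb, -, -, hpb⟩ := hu
  rcases hne.lt_or_gt with hlt | hgt
  · refine ⟨FI1inv u, (FI1genMem.base hX).inv, ?_, ?_⟩ <;> simp only [FI1inv] <;> omega
  · exact ⟨u, .base hX, hgt, hpb⟩

theorem FI1mul_FI1inv_self (u : ℤ × ℤ × ℤ) : FI1mul u (FI1inv u) = (u.1, 0, u.2.2) := by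
  simp [FI1mul, FI1inv]

theorem stmt_19 (S : Set (ℤ × ℤ × ℤ)) (hS : IsInvSub S)
    (hni : ∃ u ∈ S, FI1mul u u ≠ u) :
    ∀ f ∈ FI1gen {u | u ∈ S ∧ FI1mul u u ≠ u}, FI1mul f f = f →
      ∃ g ∈ FI1gen {u | u ∈ S ∧ FI1mul u u ≠ u},
        FI1mul g g = g ∧ FI1mul g f = g ∧ g ≠ f := by
  obtain ⟨u, huS, hu⟩ := hni
  obtain ⟨v, hv, hpos, hle⟩ := exists_FI1genMem_pos_shift
    (X := {u | u ∈ S ∧ FI1mul u u ≠ u}) ⟨huS, hu⟩ (hS.2.1 huS)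
    (mt (FI1mul_self_iff u).2 hu)
  rintro ⟨a, p, b⟩ hf hff
  obtain rfl : p = 0 := (FI1mul_self_iff _).1 hff
  obtain ⟨⟨c, q, d⟩, hw, hbw, hqd⟩ := hv.exists_lt_shift hpos hle b.toNat
  have he := hw.mul hw.inv
  rw [FI1mul_FI1inv_self] at he
  refine ⟨FI1mul (a, 0, b) (c, 0, d), FI1genMem.mul hf he, ?_, ?_, ?_⟩
  · simp [FI1mul]
  · simp [FI1mul]
  · simp only [FI1mul, ne_eq, Prod.mk.injEq]
    dsimp only at hbw hqd
    omega
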